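/- Invertibility of Sylvester flows, diagonal case: let M ≤ D, let Q be a real D×M matrix with orthonormal columns (Qᵀ Q = I_M), let R and R̃ be M×M diagonal real matrices, let b ∈ ℝ^M, and let h : ℝ → ℝ be continuously differentiable with derivative h' satisfying 0 < h'(x) ≤ C for all x ∈ ℝ and some constant C > 0. If C · R_{ii} · R̃_{ii} > -1 for all i = 1,…,M, then the map φ(z) = z + Q R h(R̃ Qᵀ z + b) (h applied componentwise) is a bijection of ℝ^D. -/

import Mathlib

open Matrix

theorem scalar_bij (h : ℝ → ℝ) (C r s b : ℝ) (hh : ContDiff ℝ 1 h)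
    (hh' : ∀ x : ℝ, 0 < deriv h x ∧ deriv h x ≤ C) (hd : C * r * s > -1) :
    Function.Bijective (fun v : ℝ => v + r * h (s * v + b)) := by
  have hdh : Differentiable ℝ h := hh.differentiable (by norm_num)
  have hder : ∀ v, HasDerivAt (fun v : ℝ => v + r * h (s * v + b))
      (1 + r * (deriv h (s * v + b) * s)) v := by
    intro v
    have h1 : HasDerivAt (fun v : ℝ => s * v + b) s v := by
      simpa using ((hasDerivAt_id v).const_mul s).add_const b
    have h2 := (hdh (s * v + b)).hasDerivAt.comp v h1
    exact (hasDerivAt_id v).add (h2.const_mul r)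
  obtain ⟨c, hc, hcd⟩ : ∃ c > 0, ∀ v, c ≤ deriv (fun v : ℝ => v + r * h (s * v + b)) v := by
    refine ⟨min 1 (1 + C * r * s), lt_min one_pos (by linarith), fun v => ?_⟩
    rw [(hder v).deriv]
    obtain ⟨h1, h2⟩ := hh' (s * v + b)
    rcases le_total 0 (r * s) with h0 | h0
    · exact (min_le_left _ _).trans (by nlinarith)
    · exact (min_le_right _ _).trans (by nlinarith)
  set f := (fun v : ℝ => v + r * h (s * v + b))
  have hf : Differentiable ℝ f := fun v => (hder v).differentiableAt
  have key : ∀ x y, x ≤ y → c * (y - x) ≤ f y - f x := fun x y hxy =>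
    mul_sub_le_image_sub_of_le_deriv hf hcd hxy
  constructor
  · have : StrictMono f := fun x y hxy => by
      have := key x y hxy.le
      have := mul_pos hc (sub_pos.2 hxy)
      linarith
    exact this.injective
  · refine hf.continuous.surjective ?_ ?_
    · refine Filter.tendsto_atTop_mono' _ (f₁ := fun x => c * x + f 0) ?_
        (Filter.tendsto_atTop_add_const_right _ _ (Filter.tendsto_id.const_mul_atTop hc))
      filter_upwards [Filter.eventually_ge_atTop 0] with x hx
      linarith [key 0 x hx]
    · refine Filter.tendsto_atBot_mono' _ (f₁ := fun x => c * x + f 0) ?_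
        (Filter.tendsto_atBot_add_const_right _ _ (Filter.tendsto_id.const_mul_atBot hc))
      filter_upwards [Filter.eventually_le_atBot 0] with x hx
      linarith [key x 0 hx]

theorem lift_bij {D M : ℕ} (Q : Matrix (Fin D) (Fin M) ℝ) (hQ : Qᵀ * Q = 1)
    (g : (Fin M → ℝ) → (Fin M → ℝ)) (hg : Function.Bijective (fun v => v + g v)) :
    Function.Bijective (fun z : Fin D → ℝ => z + Q.mulVec (g (Qᵀ.mulVec z))) := by
  have hq : ∀ u, Qᵀ.mulVec (Q.mulVec u) = u := fun u => by
    rw [Matrix.mulVec_mulVec, hQ, Matrix.one_mulVec]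
  constructor
  · intro z w hzw
    have h1 := congrArg (fun y => Qᵀ.mulVec y) hzw
    simp only [Matrix.mulVec_add, hq] at h1
    have h2 : Qᵀ.mulVec z = Qᵀ.mulVec w := hg.1 h1
    simp only [h2] at hzw
    exact add_right_cancel hzw
  · intro y
    obtain ⟨v, hv⟩ := hg.2 (Qᵀ.mulVec y)
    have hz : Qᵀ.mulVec (y - Q.mulVec (g v)) = v := by
      rw [Matrix.mulVec_sub, hq, ← hv]
      simp
    refine ⟨y - Q.mulVec (g v), ?_⟩
    simp only [hz]
    simp

/-- Invertibility of Sylvester flows, diagonal case: if `M ≤ D`, `Q` has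
orthonormal columns, `R` and `R̃` are diagonal, `h` is `C¹` with `0 < h' ≤ C`,
and `C * R i i * R̃ i i > -1` for all `i`, then
`φ(z) = z + Q R h(R̃ Qᵀ z + b)` is a bijection of `ℝ^D`. -/
theorem sylvester_flow_invertible_diagonal (D M : ℕ) (hMD : M ≤ D)
    (Q : Matrix (Fin D) (Fin M) ℝ) (hQ : Qᵀ * Q = 1)
    (R Rt : Matrix (Fin M) (Fin M) ℝ)
    (hR : ∀ i j : Fin M, i ≠ j → R i j = 0)
    (hRt : ∀ i j : Fin M, i ≠ j → Rt i j = 0)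
    (b : Fin M → ℝ) (h : ℝ → ℝ) (C : ℝ) (hC : 0 < C)
    (hh : ContDiff ℝ 1 h)
    (hh' : ∀ x : ℝ, 0 < deriv h x ∧ deriv h x ≤ C)
    (hdiag : ∀ i : Fin M, C * R i i * Rt i i > -1) :
    Function.Bijective (fun z : Fin D → ℝ =>
      z + Q.mulVec (R.mulVec (fun m => h ((Rt.mulVec (Qᵀ.mulVec z) + b) m)))) := by
  have diag : ∀ A : Matrix (Fin M) (Fin M) ℝ, (∀ i j : Fin M, i ≠ j → A i j = 0) →
      ∀ v i, A.mulVec v i = A i i * v i := by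
    intro A hA v i
    rw [Matrix.mulVec, dotProduct]
    refine Finset.sum_eq_single i (fun j _ hj => ?_) (by simp)
    rw [hA i j hj.symm, zero_mul]
  refine lift_bij Q hQ (fun v => R.mulVec (fun m => h ((Rt.mulVec v + b) m))) ?_
  have hb := fun i => scalar_bij h C (R i i) (Rt i i) (b i) hh hh' (hdiag i)
  have he : (fun v => v + R.mulVec (fun m => h ((Rt.mulVec v + b) m))) =
      Pi.map (fun i (v : ℝ) => v + R i i * h (Rt i i * v + b i)) := by
    funext v i
    simp [diag R hR, diag Rt hRt, Pi.map]
  rw [he]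
  exact Function.Bijective.piMap hb
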